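/- The graphon mean field equation is well-posed: for every measurable x₀ : (0,1] → ℝ^S such that x₀(u) is a probability vector on S (i.e. x₀(u)_s ≥ 0 for all s and ∑_{s∈S} x₀(u)_s = 1) for almost every u ∈ (0,1], there exists a unique continuous map φ : [0,∞) → L₂((0,1])^S such that φ(t) = x₀ + ∫₀ᵗ F^G(φ(τ)) dτ for all t ≥ 0 and such that, for every t ≥ 0, φ(t)(u) is a probability vector on S for almost every u ∈ (0,1]. -/

import Mathlib

open MeasureTheory Set Filter

/-- The `L₂` norm of a measurable family `x : (0,1] → ℝ^S`,
`‖x‖ = √(∑ s ∫₀¹ x(u,s)² du)`. -/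
noncomputable def l2norm {S : Type*} [Fintype S] (x : ℝ → S → ℝ) : ℝ :=
  Real.sqrt (∑ s, ∫ u in Ioc (0:ℝ) 1, (x u s) ^ 2)

/-- The `L₂` operator norm `|||G|||` of a kernel `G : (0,1]² → ℝ`. -/
noncomputable def graphonOpNorm (G : ℝ → ℝ → ℝ) : ℝ :=
  sSup {r : ℝ | ∃ f : ℝ → ℝ, Measurable f ∧ (∫ v in Ioc (0:ℝ) 1, (f v) ^ 2) ≤ 1 ∧
    r = Real.sqrt (∫ u in Ioc (0:ℝ) 1, (∫ v in Ioc (0:ℝ) 1, G u v * f v) ^ 2)}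

/-- The graphon drift
`F^G_{u,s}(x) = R^uni_{u,s}·x_u + x_uᵀ (∫₀¹ R^pair_{u,v,s} G(u,v) x_v dv)`. -/
noncomputable def graphonDrift {S : Type*} [Fintype S]
    (G : ℝ → ℝ → ℝ) (Runi : ℝ → S → S → ℝ) (Rpair : ℝ → ℝ → S → S → S → ℝ)
    (x : ℝ → S → ℝ) (u : ℝ) (s : S) : ℝ :=
  (∑ s', Runi u s s' * x u s') +
    ∑ s', x u s' * ∫ v in Ioc (0:ℝ) 1, ∑ sl, Rpair u v s s' sl * G u v * x v sl


/-- The unilateral rate vector `R^uni_{u,s}` built from rate functions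
`r^uni_u(s → s')`: its `s'`-component is `r^uni_u(s' → s)` for `s' ≠ s` and
`−∑_{s̃ ≠ s} r^uni_u(s → s̃)` for `s' = s`. -/
noncomputable def RuniOf {S : Type*} [Fintype S] [DecidableEq S]
    (runi : ℝ → S → S → ℝ) (u : ℝ) (s s' : S) : ℝ :=
  if s' = s then -(∑ st ∈ Finset.univ.erase s, runi u s st) else runi u s' s

/-- The pairwise rate matrix `R^pair_{u,v,s}` built from rate functions
`r^pair_{u,v}(s → s', s_l)`. -/
noncomputable def RpairOf {S : Type*} [Fintype S] [DecidableEq S]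
    (rpair : ℝ → ℝ → S → S → S → ℝ) (u v : ℝ) (s s' sl : S) : ℝ :=
  if s' = s then -(∑ st ∈ Finset.univ.erase s, rpair u v s st sl) else rpair u v s' s sl

/-- `φ` is a solution of the graphon mean field equation with initial condition `x₀`:
it is measurable, probability-vector valued (a.e.), satisfies the integral equation
`φ(t) = x₀ + ∫₀ᵗ F^G(φ(τ)) dτ` in `L₂`, and is continuous in time for the `L₂` norm. -/
def IsMFSolution {S : Type*} [Fintype S]
    (G : ℝ → ℝ → ℝ) (Runi : ℝ → S → S → ℝ) (Rpair : ℝ → ℝ → S → S → S → ℝ)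
    (x₀ : ℝ → S → ℝ) (φ : ℝ → ℝ → S → ℝ) : Prop :=
  (∀ s, Measurable fun p : ℝ × ℝ => φ p.1 p.2 s) ∧
  (∀ t, 0 ≤ t → ∀ᵐ u ∂(volume.restrict (Ioc (0:ℝ) 1)),
      (∀ s, 0 ≤ φ t u s) ∧ ∑ s, φ t u s = 1) ∧
  (∀ t, 0 ≤ t → ∀ᵐ u ∂(volume.restrict (Ioc (0:ℝ) 1)), ∀ s,
      φ t u s = x₀ u s + ∫ τ in Ioc (0:ℝ) t, graphonDrift G Runi Rpair (φ τ) u s) ∧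
  (∀ t₀, 0 ≤ t₀ → Filter.Tendsto (fun t => l2norm (fun u s => φ t u s - φ t₀ u s))
      (nhdsWithin t₀ (Ici (0:ℝ))) (nhds 0))

/-! ### Auxiliary structures -/

/-- Bundled standing assumptions on the coefficients. -/
structure GoodCoef {S : Type*} [Fintype S] (G : ℝ → ℝ → ℝ) (Runi : ℝ → S → S → ℝ)
    (Rpair : ℝ → ℝ → S → S → S → ℝ) (D : ℝ) : Prop where
  Gm : Measurable fun p : ℝ × ℝ => G p.1 p.2
  G0 : ∀ u v, 0 ≤ G u v
  G1 : ∀ u v, G u v ≤ 1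
  Um : ∀ s s', Measurable fun u => Runi u s s'
  Pm : ∀ s s' sl, Measurable fun p : ℝ × ℝ => Rpair p.1 p.2 s s' sl
  Ub : ∀ u s s', |Runi u s s'| ≤ D
  Pb : ∀ u v s s' sl, |Rpair u v s s' sl| ≤ D
  Uo : ∀ u s s', s' ≠ s → 0 ≤ Runi u s s'
  Po : ∀ u v s s' sl, s' ≠ s → 0 ≤ Rpair u v s s' sl
  Us : ∀ u s', ∑ s, Runi u s s' = 0
  Ps : ∀ u v s' sl, ∑ s, Rpair u v s s' sl = 0
  D0 : 0 < D

/-- Everywhere probability-vector valued measurable maps. -/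
structure IsProbFam {S : Type*} [Fintype S] (x : ℝ → S → ℝ) : Prop where
  meas : ∀ s, Measurable fun u => x u s
  nn : ∀ u s, 0 ≤ x u s
  sum : ∀ u, ∑ s, x u s = 1

/-- Everywhere probability-vector valued jointly measurable paths. -/
structure IsProbPath {S : Type*} [Fintype S] (φ : ℝ → ℝ → S → ℝ) : Prop where
  meas : ∀ s, Measurable fun p : ℝ × ℝ => φ p.1 p.2 s
  nn : ∀ t u s, 0 ≤ φ t u s
  sum : ∀ t u, ∑ s, φ t u s = 1

/-- interaction part of the generator -/
noncomputable def genW {S : Type*} [Fintype S]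
    (G : ℝ → ℝ → ℝ) (Rpair : ℝ → ℝ → S → S → S → ℝ)
    (x : ℝ → S → ℝ) (u : ℝ) (s s' : S) : ℝ :=
  ∫ v in Ioc (0:ℝ) 1, ∑ sl, Rpair u v s s' sl * G u v * x v sl

section aux

variable {S : Type*} [Fintype S]

theorem IsProbPath.slice {φ : ℝ → ℝ → S → ℝ} (h : IsProbPath φ) (t : ℝ) : IsProbFam (φ t) where
  meas s := (h.meas s).comp measurable_prodMk_left
  nn := h.nn t
  sum := h.sum t

theorem IsProbFam.le_one {x : ℝ → S → ℝ} (h : IsProbFam x) (u : ℝ) (s : S) : x u s ≤ 1 := by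
  rw [← h.sum u]
  exact Finset.single_le_sum (f := fun s => x u s) (fun i _ => h.nn u i) (Finset.mem_univ s)

theorem IsProbFam.abs_le_one {x : ℝ → S → ℝ} (h : IsProbFam x) (u : ℝ) (s : S) :
    |x u s| ≤ 1 := by
  rw [abs_of_nonneg (h.nn u s)]; exact h.le_one u s

theorem IsProbFam.abs_sub_le_one {x y : ℝ → S → ℝ} (h : IsProbFam x) (h' : IsProbFam y)
    (u : ℝ) (s : S) : |x u s - y u s| ≤ 1 := by
  have := h.nn u s
  have := h.le_one u s
  have := h'.nn u s
  have := h'.le_one u s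
  rw [abs_le]; constructor <;> linarith

theorem drift_eq (G : ℝ → ℝ → ℝ) (Runi : ℝ → S → S → ℝ) (Rpair : ℝ → ℝ → S → S → S → ℝ)
    (x : ℝ → S → ℝ) (u : ℝ) (s : S) :
    graphonDrift G Runi Rpair x u s = ∑ s', x u s' * (Runi u s s' + genW G Rpair x u s s') := by
  unfold graphonDrift genW
  rw [← Finset.sum_add_distrib]
  exact Finset.sum_congr rfl fun s' _ => by ring

/-- bounded measurable functions are integrable on finite measure spaces -/
theorem integrable_bdd {α : Type*} [MeasurableSpace α] {μ : Measure α} [IsFiniteMeasure μ]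
    {f : α → ℝ} (hf : Measurable f) {C : ℝ} (h : ∀ a, |f a| ≤ C) : Integrable f μ :=
  Integrable.of_bound hf.aestronglyMeasurable C (Eventually.of_forall h)

variable {G : ℝ → ℝ → ℝ} {Runi : ℝ → S → S → ℝ} {Rpair : ℝ → ℝ → S → S → S → ℝ} {D : ℝ}

theorem GoodCoef.abs_RG (h : GoodCoef G Runi Rpair D) (u v : ℝ) (s s' sl : S) :
    |Rpair u v s s' sl * G u v| ≤ D := by
  rw [abs_mul, abs_of_nonneg (h.G0 u v)]
  calc _ ≤ |Rpair u v s s' sl| * 1 := by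
        gcongr; exact h.G1 u v
    _ ≤ D := by rw [mul_one]; exact h.Pb u v s s' sl

theorem GoodCoef.meas_RG (h : GoodCoef G Runi Rpair D) (s s' sl : S) :
    Measurable fun p : ℝ × ℝ => Rpair p.1 p.2 s s' sl * G p.1 p.2 :=
  (h.Pm s s' sl).mul h.Gm

theorem GoodCoef.int_term (h : GoodCoef G Runi Rpair D) {x : ℝ → S → ℝ}
    (hx : IsProbFam x) (u : ℝ) (s s' sl : S) :
    Integrable (fun v => Rpair u v s s' sl * G u v * x v sl) (volume.restrict (Ioc (0:ℝ) 1)) := by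
  refine integrable_bdd (C := D)
    (((h.meas_RG s s' sl).comp measurable_prodMk_left).mul (hx.meas sl)) fun v => ?_
  rw [abs_mul]
  calc _ ≤ D * 1 := mul_le_mul (h.abs_RG u v s s' sl) (hx.abs_le_one v sl) (abs_nonneg _) h.D0.le
    _ = D := mul_one D

theorem GoodCoef.int_W (h : GoodCoef G Runi Rpair D) {x : ℝ → S → ℝ}
    (hx : IsProbFam x) (u : ℝ) (s s' : S) :
    Integrable (fun v => ∑ sl, Rpair u v s s' sl * G u v * x v sl)
      (volume.restrict (Ioc (0:ℝ) 1)) :=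
  integrable_finsetSum _ fun sl _ => h.int_term hx u s s' sl

theorem GoodCoef.abs_W_integrand (h : GoodCoef G Runi Rpair D) {x : ℝ → S → ℝ}
    (hx : IsProbFam x) (u v : ℝ) (s s' : S) :
    |∑ sl, Rpair u v s s' sl * G u v * x v sl| ≤ D := by
  calc _ ≤ ∑ sl, |Rpair u v s s' sl * G u v * x v sl| := Finset.abs_sum_le_sum_abs _ _
    _ ≤ ∑ sl, D * x v sl := by
        refine Finset.sum_le_sum fun sl _ => ?_
        rw [abs_mul, abs_of_nonneg (hx.nn v sl)]
        exact mul_le_mul_of_nonneg_right (h.abs_RG u v s s' sl) (hx.nn v sl)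
    _ = D := by rw [← Finset.mul_sum, hx.sum, mul_one]

theorem GoodCoef.abs_W (h : GoodCoef G Runi Rpair D) {x : ℝ → S → ℝ}
    (hx : IsProbFam x) (u : ℝ) (s s' : S) : |genW G Rpair x u s s'| ≤ D := by
  have := norm_integral_le_of_norm_le_const (μ := volume.restrict (Ioc (0:ℝ) 1))
    (f := fun v => ∑ sl, Rpair u v s s' sl * G u v * x v sl) (C := D)
    (Eventually.of_forall fun v => h.abs_W_integrand hx u v s s')
  simpa [genW] using this

theorem GoodCoef.W_nonneg (h : GoodCoef G Runi Rpair D) {x : ℝ → S → ℝ}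
    (hx : IsProbFam x) (u : ℝ) (s s' : S) (hs : s' ≠ s) : 0 ≤ genW G Rpair x u s s' := by
  refine integral_nonneg fun v => Finset.sum_nonneg fun sl _ => ?_
  exact mul_nonneg (mul_nonneg (h.Po u v s s' sl hs) (h.G0 u v)) (hx.nn v sl)

theorem GoodCoef.W_sum (h : GoodCoef G Runi Rpair D) {x : ℝ → S → ℝ}
    (hx : IsProbFam x) (u : ℝ) (s' : S) : ∑ s, genW G Rpair x u s s' = 0 := by
  unfold genW
  rw [← integral_finsetSum _ fun s _ => h.int_W hx u s s']
  have : (fun v => ∑ s, ∑ sl, Rpair u v s s' sl * G u v * x v sl) = fun _ => 0 := by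
    funext v
    rw [Finset.sum_comm]
    refine Finset.sum_eq_zero fun sl _ => ?_
    rw [← Finset.sum_mul, ← Finset.sum_mul, h.Ps, zero_mul, zero_mul]
  simp [this]

theorem GoodCoef.abs_W_sub (h : GoodCoef G Runi Rpair D) {x y : ℝ → S → ℝ}
    (hx : IsProbFam x) (hy : IsProbFam y) (u : ℝ) (s s' : S) :
    |genW G Rpair x u s s' - genW G Rpair y u s s'| ≤
      D * ∑ sl, ∫ v in Ioc (0:ℝ) 1, |x v sl - y v sl| := by
  have hi : ∀ sl, Integrable (fun v => |x v sl - y v sl|) (volume.restrict (Ioc (0:ℝ) 1)) :=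
    fun sl => (integrable_bdd ((hx.meas sl).sub (hy.meas sl))
      fun v => hx.abs_sub_le_one hy v sl).abs
  unfold genW
  rw [← integral_sub (h.int_W hx u s s') (h.int_W hy u s s'), ← integral_finsetSum _ fun s _ => hi s,
    ← integral_const_mul, ← Real.norm_eq_abs]
  refine norm_integral_le_of_norm_le ((integrable_finsetSum _ fun s _ => hi s).const_mul D)
    (Eventually.of_forall fun v => ?_)
  rw [← Finset.sum_sub_distrib, Finset.mul_sum, Real.norm_eq_abs]
  refine (Finset.abs_sum_le_sum_abs _ _).trans (Finset.sum_le_sum fun sl _ => ?_)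
  rw [← mul_sub, abs_mul]
  exact mul_le_mul_of_nonneg_right (h.abs_RG u v s s' sl) (abs_nonneg _)

theorem GoodCoef.abs_q (h : GoodCoef G Runi Rpair D) {x : ℝ → S → ℝ}
    (hx : IsProbFam x) (u : ℝ) (s s' : S) : |Runi u s s' + genW G Rpair x u s s'| ≤ 2 * D := by
  have h1 := h.Ub u s s'
  have h2 := h.abs_W hx u s s'
  exact (abs_add_le _ _).trans (by linarith)

theorem GoodCoef.abs_drift (h : GoodCoef G Runi Rpair D) {x : ℝ → S → ℝ}
    (hx : IsProbFam x) (u : ℝ) (s : S) : |graphonDrift G Runi Rpair x u s| ≤ 2 * D := by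
  rw [drift_eq]
  calc _ ≤ ∑ s', |x u s' * (Runi u s s' + genW G Rpair x u s s')| :=
        Finset.abs_sum_le_sum_abs _ _
    _ ≤ ∑ s', x u s' * (2 * D) := by
        refine Finset.sum_le_sum fun s' _ => ?_
        rw [abs_mul, abs_of_nonneg (hx.nn u s')]
        exact mul_le_mul_of_nonneg_left (h.abs_q hx u s s') (hx.nn u s')
    _ = 2 * D := by rw [← Finset.sum_mul, hx.sum, one_mul]

theorem GoodCoef.drift_sum (h : GoodCoef G Runi Rpair D) {x : ℝ → S → ℝ}
    (hx : IsProbFam x) (u : ℝ) : ∑ s, graphonDrift G Runi Rpair x u s = 0 := by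
  simp_rw [drift_eq]
  rw [Finset.sum_comm]
  refine Finset.sum_eq_zero fun s' _ => ?_
  rw [← Finset.mul_sum, Finset.sum_add_distrib, h.Us, h.W_sum hx]; simp

theorem GoodCoef.drift_nonneg (h : GoodCoef G Runi Rpair D) {x : ℝ → S → ℝ}
    (hx : IsProbFam x) (u : ℝ) (s : S) :
    0 ≤ graphonDrift G Runi Rpair x u s + 2 * D * x u s := by
  classical
  rw [drift_eq, ← Finset.add_sum_erase _ _ (Finset.mem_univ s)]
  have h1 : 0 ≤ ∑ s' ∈ Finset.univ.erase s, x u s' * (Runi u s s' + genW G Rpair x u s s') := by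
    refine Finset.sum_nonneg fun s' hs' => ?_
    have hne := Finset.ne_of_mem_erase hs'
    exact mul_nonneg (hx.nn u s') (add_nonneg (h.Uo u s s' hne) (h.W_nonneg hx u s s' hne))
  have h2 := (abs_le.1 (h.abs_q hx u s s)).1
  nlinarith [hx.nn u s, mul_nonneg (hx.nn u s) (by linarith : 0 ≤ Runi u s s + genW G Rpair x u s s + 2 * D)]

theorem GoodCoef.drift_lip (h : GoodCoef G Runi Rpair D) {x y : ℝ → S → ℝ}
    (hx : IsProbFam x) (hy : IsProbFam y) (u : ℝ) (s : S) :
    |graphonDrift G Runi Rpair x u s - graphonDrift G Runi Rpair y u s| ≤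
      2 * D * ∑ s', |x u s' - y u s'| + D * ∑ sl, ∫ v in Ioc (0:ℝ) 1, |x v sl - y v sl| := by
  rw [drift_eq, drift_eq, ← Finset.sum_sub_distrib]
  set A := D * ∑ sl, ∫ v in Ioc (0:ℝ) 1, |x v sl - y v sl|
  calc _ ≤ ∑ s', |x u s' * (Runi u s s' + genW G Rpair x u s s')
            - y u s' * (Runi u s s' + genW G Rpair y u s s')| := Finset.abs_sum_le_sum_abs _ _
    _ ≤ ∑ s', (2 * D * |x u s' - y u s'| + y u s' * A) := by
        refine Finset.sum_le_sum fun s' _ => ?_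
        have e : x u s' * (Runi u s s' + genW G Rpair x u s s')
            - y u s' * (Runi u s s' + genW G Rpair y u s s')
            = (Runi u s s' + genW G Rpair x u s s') * (x u s' - y u s')
              + y u s' * (genW G Rpair x u s s' - genW G Rpair y u s s') := by ring
        rw [e]
        refine (abs_add_le _ _).trans (add_le_add ?_ ?_)
        · rw [abs_mul]
          exact mul_le_mul_of_nonneg_right (h.abs_q hx u s s') (abs_nonneg _)
        · rw [abs_mul, abs_of_nonneg (hy.nn u s')]
          exact mul_le_mul_of_nonneg_left (h.abs_W_sub hx hy u s s') (hy.nn u s')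
    _ = _ := by
        rw [Finset.sum_add_distrib, ← Finset.mul_sum, ← Finset.sum_mul, hy.sum, one_mul]

theorem GoodCoef.drift_lip_sup (h : GoodCoef G Runi Rpair D) {x y : ℝ → S → ℝ}
    (hx : IsProbFam x) (hy : IsProbFam y) {δ : ℝ} (hδ : ∀ u s, |x u s - y u s| ≤ δ)
    (u : ℝ) (s : S) :
    |graphonDrift G Runi Rpair x u s - graphonDrift G Runi Rpair y u s| ≤
      3 * D * Fintype.card S * δ := by
  have h1 : ∑ s', |x u s' - y u s'| ≤ Fintype.card S * δ := by
    simpa using Finset.sum_le_sum fun s' (_ : s' ∈ Finset.univ) => hδ u s'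
  have h2 : ∑ sl, ∫ v in Ioc (0:ℝ) 1, |x v sl - y v sl| ≤ Fintype.card S * δ := by
    have : ∀ sl, ∫ v in Ioc (0:ℝ) 1, |x v sl - y v sl| ≤ δ := fun sl => by
      have := norm_integral_le_of_norm_le_const (μ := volume.restrict (Ioc (0:ℝ) 1))
        (f := fun v => |x v sl - y v sl|) (C := δ)
        (Eventually.of_forall fun v => by simpa using hδ v sl)
      exact (le_abs_self _).trans (by simpa using this)
    simpa using Finset.sum_le_sum fun s' (_ : s' ∈ Finset.univ) => this s'
  have := h.drift_lip hx hy u s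
  have hD := h.D0
  nlinarith [mul_le_mul_of_nonneg_left h1 hD.le, mul_le_mul_of_nonneg_left h2 hD.le]

theorem GoodCoef.meas_drift (h : GoodCoef G Runi Rpair D) {φ : ℝ → ℝ → S → ℝ}
    (hφ : ∀ s, Measurable fun p : ℝ × ℝ => φ p.1 p.2 s) (s : S) :
    Measurable fun p : ℝ × ℝ => graphonDrift G Runi Rpair (φ p.1) p.2 s := by
  unfold graphonDrift
  refine (Finset.measurable_sum _ fun s' _ => ((h.Um s s').comp measurable_snd).mul (hφ s')).add
    (Finset.measurable_sum _ fun s' _ => (hφ s').mul ?_)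
  have : Measurable fun q : (ℝ × ℝ) × ℝ =>
      ∑ sl, Rpair q.1.2 q.2 s s' sl * G q.1.2 q.2 * φ q.1.1 q.2 sl := by
    refine Finset.measurable_sum _ fun sl _ => ?_
    have m1 : Measurable fun q : (ℝ × ℝ) × ℝ => (q.1.2, q.2) := by fun_prop
    have m2 : Measurable fun q : (ℝ × ℝ) × ℝ => (q.1.1, q.2) := by fun_prop
    exact ((h.meas_RG s s' sl).comp m1).mul ((hφ sl).comp m2)
  exact (this.stronglyMeasurable.integral_prod_right
    (ν := volume.restrict (Ioc (0:ℝ) 1))).measurable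

theorem GoodCoef.cont_drift (h : GoodCoef G Runi Rpair D) {φ : ℝ → ℝ → S → ℝ}
    (hφ : IsProbPath φ) (hc : ∀ u s, Continuous fun t => φ t u s) (u : ℝ) (s : S) :
    Continuous fun t => graphonDrift G Runi Rpair (φ t) u s := by
  unfold graphonDrift
  refine (continuous_finsetSum _ fun s' _ => continuous_const.mul (hc u s')).add
    (continuous_finsetSum _ fun s' _ => (hc u s').mul ?_)
  refine continuous_of_dominated (bound := fun _ => D) (fun t => ?_) (fun t => ?_)
    (integrable_const _) (Eventually.of_forall fun v => ?_)
  · exact (h.int_W (hφ.slice t) u s s').aestronglyMeasurable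
  · exact Eventually.of_forall fun v => h.abs_W_integrand (hφ.slice t) u v s s'
  · exact continuous_finsetSum _ fun sl _ => continuous_const.mul (hc v sl)

end aux

section picard

variable {S : Type*} [Fintype S]

/-- The (exponentially weighted) Picard map. -/
noncomputable def picardMap (G : ℝ → ℝ → ℝ) (Runi : ℝ → S → S → ℝ)
    (Rpair : ℝ → ℝ → S → S → S → ℝ) (D : ℝ) (x₀ : ℝ → S → ℝ) (φ : ℝ → ℝ → S → ℝ)
    (t u : ℝ) (s : S) : ℝ :=
  Real.exp (-(2 * D * max t 0)) * (x₀ u s + ∫ τ in (0:ℝ)..(max t 0),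
    Real.exp (2 * D * τ) * (graphonDrift G Runi Rpair (φ τ) u s + 2 * D * φ τ u s))

theorem intervalIntegrable_bdd {f : ℝ → ℝ} (hf : Measurable f) {C : ℝ} (h : ∀ a, |f a| ≤ C)
    (a b : ℝ) : IntervalIntegrable f volume a b :=
  ⟨integrable_bdd hf h, integrable_bdd hf h⟩

theorem integral_exp_mul' {K : ℝ} (hK : K ≠ 0) (T : ℝ) :
    ∫ τ in (0:ℝ)..T, Real.exp (K * τ) = (Real.exp (K * T) - 1) / K := by
  rw [intervalIntegral.integral_comp_mul_left (fun x => Real.exp x) hK, integral_exp]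
  simp [div_eq_inv_mul]

variable {G : ℝ → ℝ → ℝ} {Runi : ℝ → S → S → ℝ} {Rpair : ℝ → ℝ → S → S → S → ℝ} {D : ℝ}

theorem GoodCoef.meas_drift_t (h : GoodCoef G Runi Rpair D) {φ : ℝ → ℝ → S → ℝ}
    (hφ : IsProbPath φ) (u : ℝ) (s : S) :
    Measurable fun t => graphonDrift G Runi Rpair (φ t) u s :=
  (h.meas_drift hφ.meas s).comp measurable_prodMk_right

theorem IsProbPath.meas_t {φ : ℝ → ℝ → S → ℝ} (hφ : IsProbPath φ) (u : ℝ) (s : S) :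
    Measurable fun t => φ t u s :=
  (hφ.meas s).comp measurable_prodMk_right

theorem GoodCoef.ii_H (h : GoodCoef G Runi Rpair D) {φ : ℝ → ℝ → S → ℝ}
    (hφ : IsProbPath φ) (u : ℝ) (s : S) (a b : ℝ) :
    IntervalIntegrable (fun τ => graphonDrift G Runi Rpair (φ τ) u s + 2 * D * φ τ u s)
      volume a b := by
  refine (intervalIntegrable_bdd (h.meas_drift_t hφ u s)
    (fun τ => h.abs_drift (hφ.slice τ) u s) a b).add
    ((intervalIntegrable_bdd (hφ.meas_t u s)
      (fun τ => (hφ.slice τ).abs_le_one u s) a b).const_mul _)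

theorem GoodCoef.ii_eH (h : GoodCoef G Runi Rpair D) {φ : ℝ → ℝ → S → ℝ}
    (hφ : IsProbPath φ) (u : ℝ) (s : S) (a b : ℝ) :
    IntervalIntegrable (fun τ => Real.exp (2 * D * τ) *
      (graphonDrift G Runi Rpair (φ τ) u s + 2 * D * φ τ u s)) volume a b :=
  (h.ii_H hφ u s a b).continuousOn_mul (by fun_prop)

theorem GoodCoef.picard_cont (h : GoodCoef G Runi Rpair D) (x₀ : ℝ → S → ℝ) {φ : ℝ → ℝ → S → ℝ}
    (hφ : IsProbPath φ) (u : ℝ) (s : S) :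
    Continuous fun t => picardMap G Runi Rpair D x₀ φ t u s := by
  unfold picardMap
  have := intervalIntegral.continuous_primitive (fun a b => h.ii_eH hφ u s a b) 0
  have hm : Continuous fun t : ℝ => max t 0 := by fun_prop
  exact (by fun_prop : Continuous fun t : ℝ => Real.exp (-(2 * D * max t 0))).mul
    (continuous_const.add (this.comp hm))

theorem GoodCoef.picard_prob (h : GoodCoef G Runi Rpair D) {x₀ : ℝ → S → ℝ} (hx₀ : IsProbFam x₀)
    {φ : ℝ → ℝ → S → ℝ} (hφ : IsProbPath φ) :
    IsProbPath (picardMap G Runi Rpair D x₀ φ) where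
  meas s := by
    refine measurable_uncurry_of_continuous_of_measurable
      (u := fun t u => picardMap G Runi Rpair D x₀ φ t u s) (fun u => h.picard_cont x₀ hφ u s)
      fun t => ?_
    unfold picardMap
    refine measurable_const.mul ((hx₀.meas s).add ?_)
    simp_rw [intervalIntegral.integral_of_le (le_max_right t (0:ℝ))]
    have : Measurable fun q : ℝ × ℝ => Real.exp (2 * D * q.2) *
        (graphonDrift G Runi Rpair (φ q.2) q.1 s + 2 * D * φ q.2 q.1 s) := by
      refine Measurable.mul (by fun_prop) ?_
      exact ((h.meas_drift hφ.meas s).comp measurable_swap).add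
        (((hφ.meas s).comp measurable_swap).const_mul _)
    exact (this.stronglyMeasurable.integral_prod_right
      (ν := volume.restrict (Ioc (0:ℝ) (max t 0)))).measurable
  nn t u s := by
    refine mul_nonneg (Real.exp_nonneg _) (add_nonneg (hx₀.nn u s) ?_)
    refine intervalIntegral.integral_nonneg (le_max_right _ _) fun τ _ => ?_
    exact mul_nonneg (Real.exp_nonneg _) (h.drift_nonneg (hφ.slice τ) u s)
  sum t u := by
    unfold picardMap
    rw [← Finset.mul_sum, Finset.sum_add_distrib, hx₀.sum,
      ← intervalIntegral.integral_finsetSum fun s _ => h.ii_eH hφ u s _ _]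
    have e : ∀ τ, ∑ s, Real.exp (2 * D * τ) *
        (graphonDrift G Runi Rpair (φ τ) u s + 2 * D * φ τ u s) =
        Real.exp (2 * D * τ) * (2 * D) := fun τ => by
      rw [← Finset.mul_sum, Finset.sum_add_distrib, h.drift_sum (hφ.slice τ), ← Finset.mul_sum,
        hφ.sum, zero_add, mul_one]
    have hD := h.D0
    simp_rw [e]
    rw [intervalIntegral.integral_mul_const, integral_exp_mul' (by positivity),
      div_mul_cancel₀ _ (by positivity), add_sub_cancel, ← Real.exp_add]
    simp

/-- Lipschitz constant. -/
noncomputable def lipC (S : Type*) [Fintype S] (D : ℝ) : ℝ := 3 * D * Fintype.card S + 2 * D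

theorem GoodCoef.picard_contr (h : GoodCoef G Runi Rpair D) (x₀ : ℝ → S → ℝ)
    {φ ψ : ℝ → ℝ → S → ℝ} (hφ : IsProbPath φ) (hψ : IsProbPath ψ) {c : ℝ} (hc : 0 ≤ c)
    (hd : ∀ t u s, |φ t u s - ψ t u s| ≤ c * Real.exp (2 * lipC S D * max t 0)) (t u : ℝ) (s : S) :
    |picardMap G Runi Rpair D x₀ φ t u s - picardMap G Runi Rpair D x₀ ψ t u s| ≤
      c / 2 * Real.exp (2 * lipC S D * max t 0) := by
  have hD := h.D0
  have hL : 0 < lipC S D := by unfold lipC; positivity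
  unfold picardMap
  set T := max t 0
  have hT : 0 ≤ T := le_max_right _ _
  rw [← mul_sub, add_sub_add_left_eq_sub,
    ← intervalIntegral.integral_sub (h.ii_eH hφ u s _ _) (h.ii_eH hψ u s _ _),
    ← intervalIntegral.integral_const_mul, ← Real.norm_eq_abs]
  have key : ∀ τ ∈ Ioc 0 T, ‖Real.exp (-(2 * D * T)) * (Real.exp (2 * D * τ) *
      (graphonDrift G Runi Rpair (φ τ) u s + 2 * D * φ τ u s) - Real.exp (2 * D * τ) *
      (graphonDrift G Runi Rpair (ψ τ) u s + 2 * D * ψ τ u s))‖ ≤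
      lipC S D * c * Real.exp (2 * lipC S D * τ) := by
    intro τ hτ
    rw [← mul_sub, ← mul_assoc, ← Real.exp_add, norm_mul, Real.norm_eq_abs, Real.norm_eq_abs,
      Real.abs_exp]
    have h1 : Real.exp (-(2 * D * T) + 2 * D * τ) ≤ 1 := by
      rw [Real.exp_le_one_iff]; nlinarith [hτ.2]
    have hd' : ∀ u s, |φ τ u s - ψ τ u s| ≤ c * Real.exp (2 * lipC S D * τ) := fun u s => by
      have := hd τ u s
      rwa [max_eq_left hτ.1.le] at this
    have h2 := h.drift_lip_sup (hφ.slice τ) (hψ.slice τ) hd' u s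
    have h3 : |graphonDrift G Runi Rpair (φ τ) u s + 2 * D * φ τ u s -
      (graphonDrift G Runi Rpair (ψ τ) u s + 2 * D * ψ τ u s)| ≤
      lipC S D * (c * Real.exp (2 * lipC S D * τ)) := by
      rw [add_sub_add_comm, ← mul_sub]
      refine (abs_add_le _ _).trans ?_
      rw [abs_mul, abs_of_pos (by positivity : 0 < 2 * D)]
      have h4 := mul_le_mul_of_nonneg_left (hd' u s) (by positivity : 0 ≤ 2 * D)
      have : lipC S D * (c * Real.exp (2 * lipC S D * τ)) =
        3 * D * Fintype.card S * (c * Real.exp (2 * lipC S D * τ)) +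
          2 * D * (c * Real.exp (2 * lipC S D * τ)) := by
        conv_lhs => rw [lipC]
        ring_nf
        simp only [lipC]
        ring_nf
      linarith
    rw [mul_assoc (lipC S D) c]
    exact (mul_le_of_le_one_left (abs_nonneg _) h1).trans h3
  refine (intervalIntegral.norm_integral_le_of_norm_le hT
    (Eventually.of_forall key) (Continuous.intervalIntegrable (by fun_prop) _ _)).trans ?_
  rw [intervalIntegral.integral_const_mul, integral_exp_mul' (by positivity)]
  have : lipC S D * c * ((Real.exp (2 * lipC S D * T) - 1) / (2 * lipC S D)) =
    c / 2 * Real.exp (2 * lipC S D * T) - c / 2 := by field_simp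
  rw [this]; linarith

theorem GoodCoef.exists_fixed (h : GoodCoef G Runi Rpair D) {x₀ : ℝ → S → ℝ}
    (hx₀ : IsProbFam x₀) :
    ∃ φ, IsProbPath φ ∧ picardMap G Runi Rpair D x₀ φ = φ := by
  set P := picardMap G Runi Rpair D x₀ with hP
  set f : ℕ → ℝ → ℝ → S → ℝ := fun n => P^[n] (fun _ => x₀) with hf
  have fs : ∀ n, f (n+1) = P (f n) := fun n => Function.iterate_succ_apply' _ _ _
  have fp : ∀ n, IsProbPath (f n) := by
    intro n
    induction n with
    | zero => exact ⟨fun s => (hx₀.meas s).comp measurable_snd, fun _ => hx₀.nn, fun _ => hx₀.sum⟩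
    | succ n ih => rw [fs]; exact h.picard_prob hx₀ ih
  have hD := h.D0
  have hL : 0 < lipC S D := by unfold lipC; positivity
  set E : ℝ → ℝ := fun t => Real.exp (2 * lipC S D * max t 0) with hE
  have E1 : ∀ t, 1 ≤ E t := fun t => Real.one_le_exp (by positivity)
  have fd : ∀ n t u s, |f n t u s - f (n+1) t u s| ≤ (1 / 2 ^ n) * E t := by
    intro n
    induction n with
    | zero =>
      intro t u s
      refine (((fp 0).slice t).abs_sub_le_one ((fp 1).slice t) u s).trans ?_
      simpa using E1 t
    | succ n ih =>
      intro t u s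
      rw [fs (n+1), fs n]
      have := h.picard_contr x₀ (fp n) (fp (n+1)) (c := 1 / 2 ^ n) (by positivity) ih t u s
      rw [← fs n]
      rw [← hP, ← fs n] at this
      refine this.trans (le_of_eq ?_)
      simp only [hE]; field_simp; ring
  have fd' : ∀ t u s n, dist (f n t u s) (f (n+1) t u s) ≤ (2 * E t) / 2 / 2 ^ n := by
    intro t u s n
    rw [Real.dist_eq]
    refine (fd n t u s).trans (le_of_eq ?_)
    field_simp
  have hlim : ∀ t u s, ∃ y, Tendsto (fun n => f n t u s) atTop (nhds y) := fun t u s =>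
    cauchySeq_tendsto_of_complete (cauchySeq_of_le_geometric_two (fd' t u s))
  choose φ hφ using hlim
  have hφp : IsProbPath φ := by
    refine ⟨fun s => ?_, fun t u s => ?_, fun t u => ?_⟩
    · refine measurable_of_tendsto_metrizable (fun n => (fp n).meas s) ?_
      rw [tendsto_pi_nhds]
      exact fun p => hφ p.1 p.2 s
    · exact ge_of_tendsto' (hφ t u s) fun n => (fp n).nn t u s
    · have := tendsto_finsetSum Finset.univ fun s _ => hφ t u s
      simp_rw [(fp _).sum] at this
      exact (tendsto_nhds_unique this tendsto_const_nhds)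
  refine ⟨φ, hφp, ?_⟩
  funext t u s
  have hb : ∀ n t u s, |f n t u s - φ t u s| ≤ (2 / 2 ^ n) * E t := fun n t u s => by
    have := dist_le_of_le_geometric_two_of_tendsto (fd' t u s) (hφ t u s) n
    rw [Real.dist_eq] at this
    refine this.trans (le_of_eq (by ring))
  have hb2 : ∀ n, |f (n+1) t u s - P φ t u s| ≤ (1 / 2 ^ n) * E t := fun n => by
    rw [fs]
    refine (h.picard_contr x₀ (fp n) hφp (by positivity) (hb n) t u s).trans (le_of_eq ?_)
    simp only [hE]; field_simp
  have t1 : Tendsto (fun n => f (n+1) t u s) atTop (nhds (P φ t u s)) := by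
    rw [tendsto_iff_dist_tendsto_zero]
    refine squeeze_zero (fun _ => dist_nonneg) (fun n => hb2 n) ?_
    have := (tendsto_pow_atTop_nhds_zero_of_lt_one (r := (1/2:ℝ)) (by norm_num)
      (by norm_num)).mul_const (E t)
    simpa [one_div] using this
  exact tendsto_nhds_unique t1 ((hφ t u s).comp (tendsto_add_atTop_nat 1))

theorem GoodCoef.fixed_eq (h : GoodCoef G Runi Rpair D) {x₀ : ℝ → S → ℝ}
    {φ : ℝ → ℝ → S → ℝ} (hφ : IsProbPath φ) (hfix : picardMap G Runi Rpair D x₀ φ = φ)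
    (t : ℝ) (ht : 0 ≤ t) (u : ℝ) (s : S) :
    φ t u s = x₀ u s + ∫ τ in Ioc (0:ℝ) t, graphonDrift G Runi Rpair (φ τ) u s := by
  have hc : ∀ u s, Continuous fun t => φ t u s := fun u s => by
    have := h.picard_cont x₀ hφ u s
    rwa [hfix] at this
  have hdc := h.cont_drift hφ hc u s
  set H : ℝ → ℝ := fun τ => graphonDrift G Runi Rpair (φ τ) u s + 2 * D * φ τ u s with hH
  have hHc : Continuous H := hdc.add (continuous_const.mul (hc u s))
  set J : ℝ → ℝ := fun t => Real.exp (-(2 * D * t)) *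
    (x₀ u s + ∫ τ in (0:ℝ)..t, Real.exp (2 * D * τ) * H τ) with hJ
  have hJφ : ∀ t, 0 ≤ t → J t = φ t u s := fun t ht => by
    conv_rhs => rw [← hfix]
    simp only [picardMap, max_eq_left ht, hJ, hH]
  have hJd : ∀ t, HasDerivAt J (H t - 2 * D * J t) t := fun t => by
    have hcc : Continuous fun τ => Real.exp (2 * D * τ) * H τ := by fun_prop
    have d1 : HasDerivAt (fun t => x₀ u s + ∫ τ in (0:ℝ)..t, Real.exp (2 * D * τ) * H τ)
        (Real.exp (2 * D * t) * H t) t :=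
      (intervalIntegral.integral_hasDerivAt_right (hcc.intervalIntegrable _ _)
        hcc.stronglyMeasurable.stronglyMeasurableAtFilter hcc.continuousAt).const_add _
    have d2 : HasDerivAt (fun t : ℝ => Real.exp (-(2 * D * t)))
        (Real.exp (-(2 * D * t)) * (-(2 * D * 1))) t :=
      (((hasDerivAt_id t).const_mul (2 * D)).neg).exp
    refine (d2.mul d1).congr_deriv ?_
    simp only [hJ]
    have : Real.exp (-(2 * D * t)) * Real.exp (2 * D * t) = 1 := by
      rw [← Real.exp_add]; simp
    linear_combination H t * this
  have hJc : Continuous J := continuous_iff_continuousAt.2 fun t => (hJd t).continuousAt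
  have := intervalIntegral.integral_eq_sub_of_hasDerivAt (a := 0) (b := t) (fun x _ => hJd x)
    (Continuous.intervalIntegrable (by fun_prop) _ _)
  have J0 : J 0 = x₀ u s := by simp [hJ]
  rw [hJφ t ht, J0, intervalIntegral.integral_of_le ht] at this
  rw [← sub_eq_iff_eq_add', ← this]
  refine setIntegral_congr_fun measurableSet_Ioc fun τ hτ => ?_
  simp only [hJφ τ hτ.1.le, hH]; ring

theorem GoodCoef.exists_sol (h : GoodCoef G Runi Rpair D) {x₀ : ℝ → S → ℝ}
    (hx₀ : IsProbFam x₀) :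
    ∃ φ, IsProbPath φ ∧ IsMFSolution G Runi Rpair x₀ φ := by
  obtain ⟨φ, hφ, hfix⟩ := h.exists_fixed hx₀
  have hc : ∀ u s, Continuous fun t => φ t u s := fun u s => by
    have := h.picard_cont x₀ hφ u s
    rwa [hfix] at this
  refine ⟨φ, hφ, hφ.meas, fun t _ => Eventually.of_forall fun u => ⟨hφ.nn t u, hφ.sum t u⟩,
    fun t ht => Eventually.of_forall fun u s => h.fixed_eq hφ hfix t ht u s, fun t₀ _ => ?_⟩
  have : Continuous fun t => l2norm (fun u s => φ t u s - φ t₀ u s) := by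
    unfold l2norm
    refine Real.continuous_sqrt.comp (continuous_finsetSum _ fun s _ => ?_)
    refine continuous_of_dominated (bound := fun _ => 1) (fun t => ?_) (fun t => ?_)
      (integrable_const _) (Eventually.of_forall fun u => ?_)
    · exact ((((hφ.slice t).meas s).sub ((hφ.slice t₀).meas s)).pow_const 2).aestronglyMeasurable
    · refine Eventually.of_forall fun u => ?_
      rw [norm_pow, Real.norm_eq_abs]
      exact pow_le_one₀ (abs_nonneg _) ((hφ.slice t).abs_sub_le_one (hφ.slice t₀) u s)
    · exact ((hc u s).sub continuous_const).pow 2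
  have h2 := (this.tendsto t₀).mono_left (nhdsWithin_le_nhds (s := Ici (0:ℝ)))
  simpa [l2norm] using h2

end picard

section uniq

variable {S : Type*} [Fintype S]

theorem gronwall_zero {a : ℝ → ℝ} (ham : Measurable a) {M L : ℝ} (hL : 0 < L)
    (hM : ∀ t, |a t| ≤ M) (ha : ∀ t, 0 ≤ t → a t ≤ L * ∫ τ in Ioc (0:ℝ) t, a τ)
    (t : ℝ) (ht : 0 ≤ t) : a t ≤ 0 := by
  have hM0 : 0 ≤ M := (abs_nonneg _).trans (hM 0)
  have key : ∀ n : ℕ, ∀ t, 0 ≤ t → a t ≤ M / 2 ^ n * Real.exp (2 * L * t) := by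
    intro n
    induction n with
    | zero =>
      intro t ht
      have h1 : 1 ≤ Real.exp (2 * L * t) := Real.one_le_exp (by positivity)
      have := (le_abs_self _).trans (hM t)
      simp only [pow_zero, div_one]
      nlinarith
    | succ n ih =>
      intro t ht
      have h1 : ∫ τ in Ioc (0:ℝ) t, a τ ≤ ∫ τ in Ioc (0:ℝ) t, M / 2 ^ n * Real.exp (2 * L * τ) := by
        refine setIntegral_mono_on (integrable_bdd ham hM) ?_ measurableSet_Ioc
          fun τ hτ => ih τ hτ.1.le
        exact (Continuous.integrableOn_Icc (by fun_prop)).mono_set Ioc_subset_Icc_self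
      rw [← intervalIntegral.integral_of_le ht (f := fun τ => M / 2 ^ n * Real.exp (2 * L * τ)),
        intervalIntegral.integral_const_mul, integral_exp_mul' (by positivity)] at h1
      have h2 := (ha t ht).trans (mul_le_mul_of_nonneg_left h1 hL.le)
      have h3 : L * (M / 2 ^ n * ((Real.exp (2 * L * t) - 1) / (2 * L))) =
          M / 2 ^ (n+1) * Real.exp (2 * L * t) - M / 2 ^ (n+1) := by
        field_simp; ring
      have : 0 ≤ M / 2 ^ (n+1) := by positivity
      linarith
  have hlim : Tendsto (fun n : ℕ => M / 2 ^ n * Real.exp (2 * L * t)) atTop (nhds 0) := by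
    have := ((tendsto_pow_atTop_nhds_zero_of_lt_one (r := (1/2:ℝ)) (by norm_num)
      (by norm_num)).const_mul M).mul_const (Real.exp (2 * L * t))
    simpa [one_div, div_eq_mul_inv] using this
  exact ge_of_tendsto' hlim fun n => key n t ht

variable {G : ℝ → ℝ → ℝ} {Runi : ℝ → S → S → ℝ} {Rpair : ℝ → ℝ → S → S → S → ℝ} {D : ℝ}

theorem GoodCoef.unique_clean [Nonempty S] (h : GoodCoef G Runi Rpair D) {x₀ : ℝ → S → ℝ}
    {φ ψ : ℝ → ℝ → S → ℝ} (hφ : IsProbPath φ) (hψ : IsProbPath ψ)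
    (eφ : ∀ t, 0 ≤ t → ∀ᵐ u ∂(volume.restrict (Ioc (0:ℝ) 1)), ∀ s,
      φ t u s = x₀ u s + ∫ τ in Ioc (0:ℝ) t, graphonDrift G Runi Rpair (φ τ) u s)
    (eψ : ∀ t, 0 ≤ t → ∀ᵐ u ∂(volume.restrict (Ioc (0:ℝ) 1)), ∀ s,
      ψ t u s = x₀ u s + ∫ τ in Ioc (0:ℝ) t, graphonDrift G Runi Rpair (ψ τ) u s)
    (t : ℝ) (ht : 0 ≤ t) (s : S) :
    ∀ᵐ u ∂(volume.restrict (Ioc (0:ℝ) 1)), φ t u s = ψ t u s := by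
  have hD := h.D0
  have hdm : ∀ s, Measurable fun p : ℝ × ℝ => |φ p.1 p.2 s - ψ p.1 p.2 s| := fun s =>
    continuous_abs.measurable.comp ((hφ.meas s).sub (hψ.meas s))
  have hd1 : ∀ t u s, |(|φ t u s - ψ t u s|)| ≤ 1 := fun t u s => by
    rw [abs_abs]; exact (hφ.slice t).abs_sub_le_one (hψ.slice t) u s
  have hdi : ∀ t s, Integrable (fun u => |φ t u s - ψ t u s|) (volume.restrict (Ioc (0:ℝ) 1)) :=
    fun t s => integrable_bdd ((hdm s).comp measurable_prodMk_left) fun u => hd1 t u s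
  set a : ℝ → ℝ := fun t => ∑ s, ∫ u in Ioc (0:ℝ) 1, |φ t u s - ψ t u s| with ha
  have ham : Measurable a := Finset.measurable_sum _ fun s _ =>
    ((hdm s).stronglyMeasurable.integral_prod_right
      (ν := volume.restrict (Ioc (0:ℝ) 1))).measurable
  have haM : ∀ t, |a t| ≤ Fintype.card S := fun t => by
    refine (Finset.abs_sum_le_sum_abs _ _).trans ?_
    have : ∀ s ∈ (Finset.univ : Finset S), |(∫ u in Ioc (0:ℝ) 1, |φ t u s - ψ t u s|)| ≤ 1 := by
      intro s _
      have := norm_integral_le_of_norm_le_const (μ := volume.restrict (Ioc (0:ℝ) 1))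
        (f := fun u => |φ t u s - ψ t u s|) (C := 1) (Eventually.of_forall fun u => hd1 t u s)
      simpa using this
    simpa using Finset.sum_le_sum this
  have hai : ∀ t, Integrable a (volume.restrict (Ioc (0:ℝ) t)) := fun t => integrable_bdd ham haM
  have hineq : ∀ t, 0 ≤ t → a t ≤ (Fintype.card S * (3 * D)) * ∫ τ in Ioc (0:ℝ) t, a τ := by
    intro t ht
    have hs : ∀ s ∈ (Finset.univ : Finset S), ∫ u in Ioc (0:ℝ) 1, |φ t u s - ψ t u s| ≤
        3 * D * ∫ τ in Ioc (0:ℝ) t, a τ := by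
      intro s _
      set B : ℝ → ℝ → ℝ := fun u τ => 2 * D * ∑ s', |φ τ u s' - ψ τ u s'| + D * a τ with hB
      have hBm : Measurable fun p : ℝ × ℝ => B p.1 p.2 := by
        refine ((Finset.measurable_sum _ fun s' _ =>
          (hdm s').comp measurable_swap).const_mul _).add ?_
        exact (ham.comp measurable_snd).const_mul _
      have hBb : ∀ u τ, |B u τ| ≤ 2 * D * Fintype.card S + D * Fintype.card S := by
        intro u τ
        have h1 : |(∑ s', |φ τ u s' - ψ τ u s'|)| ≤ Fintype.card S := by
          refine (Finset.abs_sum_le_sum_abs _ _).trans ?_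
          simpa using Finset.sum_le_sum fun s' (_ : s' ∈ Finset.univ) => hd1 τ u s'
        refine (abs_add_le _ _).trans ?_
        rw [abs_mul (2 * D), abs_mul D, abs_of_pos (by positivity : 0 < 2 * D), abs_of_pos hD]
        gcongr
        exact haM τ
      have hBprod : Integrable (Function.uncurry B)
          ((volume.restrict (Ioc (0:ℝ) 1)).prod (volume.restrict (Ioc (0:ℝ) t))) :=
        integrable_bdd hBm fun p => hBb p.1 p.2
      have step1 : ∫ u in Ioc (0:ℝ) 1, |φ t u s - ψ t u s| ≤
          ∫ u in Ioc (0:ℝ) 1, ∫ τ in Ioc (0:ℝ) t, B u τ := by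
        refine integral_mono_ae (hdi t s) hBprod.integral_prod_left ?_
        filter_upwards [eφ t ht, eψ t ht] with u h1 h2
        rw [h1 s, h2 s, add_sub_add_left_eq_sub, ← integral_sub
          (integrable_bdd (h.meas_drift_t hφ u s) fun τ => h.abs_drift (hφ.slice τ) u s)
          (integrable_bdd (h.meas_drift_t hψ u s) fun τ => h.abs_drift (hψ.slice τ) u s),
          ← Real.norm_eq_abs]
        refine norm_integral_le_of_norm_le
          (integrable_bdd (hBm.comp measurable_prodMk_left) fun τ => hBb u τ)
          (Eventually.of_forall fun τ => ?_)
        exact h.drift_lip (hφ.slice τ) (hψ.slice τ) u s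
      refine step1.trans (le_of_eq ?_)
      rw [integral_integral_swap hBprod, ← integral_const_mul]
      refine integral_congr_ae (Eventually.of_forall fun τ => ?_)
      simp only [hB]
      rw [integral_add ((integrable_finsetSum _ fun s' _ => hdi τ s').const_mul _)
        (integrable_const _), integral_const_mul, integral_finsetSum _ fun s' _ => hdi τ s']
      simp [ha]; ring
    have := Finset.sum_le_sum hs
    simpa [mul_assoc] using this
  have hcard : (0:ℝ) < Fintype.card S := by exact_mod_cast Fintype.card_pos
  have h0 := gronwall_zero ham (by positivity) haM hineq t ht
  have hnn : ∀ s ∈ (Finset.univ : Finset S), 0 ≤ ∫ u in Ioc (0:ℝ) 1, |φ t u s - ψ t u s| :=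
    fun s _ => integral_nonneg fun u => abs_nonneg _
  have hz := (Finset.sum_eq_zero_iff_of_nonneg hnn).1
    (le_antisymm h0 (Finset.sum_nonneg hnn)) s (Finset.mem_univ s)
  rw [integral_eq_zero_iff_of_nonneg (fun u => abs_nonneg _) (hdi t s)] at hz
  filter_upwards [hz] with u hu
  exact sub_eq_zero.1 (abs_eq_zero.1 hu)

theorem GoodCoef.unique_sol [Nonempty S] (h : GoodCoef G Runi Rpair D) {x₀ : ℝ → S → ℝ}
    {φ ψ : ℝ → ℝ → S → ℝ} (hφ : IsProbPath φ) (sφ : IsMFSolution G Runi Rpair x₀ φ)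
    (sψ : IsMFSolution G Runi Rpair x₀ ψ) (t : ℝ) (ht : 0 ≤ t) :
    l2norm (fun u s => φ t u s - ψ t u s) = 0 := by
  classical
  obtain ⟨mψ, pψ, eψ, -⟩ := sψ
  set A : Set (ℝ × ℝ) := {p | (∀ s, 0 ≤ ψ p.1 p.2 s) ∧ ∑ s, ψ p.1 p.2 s = 1} with hA
  have hAm : MeasurableSet A := by
    have e : A = (⋂ s, {p : ℝ × ℝ | 0 ≤ ψ p.1 p.2 s}) ∩
        {p : ℝ × ℝ | ∑ s, ψ p.1 p.2 s = 1} := by ext p; simp [hA]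
    rw [e]
    refine MeasurableSet.inter ?_ ?_
    · exact MeasurableSet.iInter fun s => measurableSet_le measurable_const (mψ s)
    · exact measurableSet_eq_fun (Finset.measurable_sum _ fun s _ => mψ s) measurable_const
  set χ : ℝ → ℝ → S → ℝ := fun t u s => if (t, u) ∈ A then ψ t u s else φ t u s with hχ
  have hχp : IsProbPath χ := by
    refine ⟨fun s => Measurable.ite hAm (mψ s) (hφ.meas s), fun t u s => ?_, fun t u => ?_⟩
    · by_cases hm : (t, u) ∈ A
      · simp only [hχ, if_pos hm]; exact hm.1 s
      · simp only [hχ, if_neg hm]; exact hφ.nn t u s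
    · by_cases hm : (t, u) ∈ A
      · simp only [hχ, if_pos hm]; exact hm.2
      · simp only [hχ, if_neg hm]; exact hφ.sum t u
  have hχψ : ∀ t u, (t, u) ∈ A → χ t u = ψ t u := fun t u hm => by
    funext s; simp only [hχ, if_pos hm]
  have hχae : ∀ t, 0 ≤ t → ∀ᵐ u ∂(volume.restrict (Ioc (0:ℝ) 1)), χ t u = ψ t u := fun t ht => by
    filter_upwards [pψ t ht] with u hu using hχψ t u hu
  have eχ : ∀ t, 0 ≤ t → ∀ᵐ u ∂(volume.restrict (Ioc (0:ℝ) 1)), ∀ s,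
      χ t u s = x₀ u s + ∫ τ in Ioc (0:ℝ) t, graphonDrift G Runi Rpair (χ τ) u s := by
    intro t ht
    have hsw : ∀ᵐ u ∂(volume.restrict (Ioc (0:ℝ) 1)), ∀ᵐ τ ∂(volume.restrict (Ioc (0:ℝ) t)),
        (τ, u) ∈ A := by
      have h1 : ∀ᵐ τ ∂(volume.restrict (Ioc (0:ℝ) t)), ∀ᵐ u ∂(volume.restrict (Ioc (0:ℝ) 1)),
          (τ, u) ∈ A := by
        filter_upwards [ae_restrict_mem measurableSet_Ioc] with τ hτ using pψ τ hτ.1.le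
      exact (Measure.ae_ae_comm (p := fun τ u => (τ, u) ∈ A) hAm).1 h1
    filter_upwards [hχae t ht, eψ t ht, hsw] with u h1 h2 h3 s
    rw [h1, h2 s]
    congr 1
    refine integral_congr_ae ?_
    filter_upwards [h3, ae_restrict_mem measurableSet_Ioc] with τ h4 h5
    simp only [drift_eq]
    rw [hχψ τ u h4]
    refine Finset.sum_congr rfl fun s' _ => ?_
    congr 2
    refine integral_congr_ae ?_
    filter_upwards [hχae τ h5.1.le] with v hv
    rw [hv]
  have hfin := h.unique_clean hφ hχp sφ.2.2.1 eχ t ht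
  unfold l2norm
  rw [Finset.sum_eq_zero, Real.sqrt_zero]
  intro s _
  refine integral_eq_zero_of_ae ?_
  filter_upwards [hfin s, hχae t ht] with u h1 h2
  rw [h1, h2]; simp

theorem IsMFSolution.congr {G' : ℝ → ℝ → ℝ} {x₀ x₀' : ℝ → S → ℝ}
    (hG : ∀ u ∈ Ioc (0:ℝ) 1, ∀ v ∈ Ioc (0:ℝ) 1, G u v = G' u v)
    (hx : ∀ᵐ u ∂(volume.restrict (Ioc (0:ℝ) 1)), x₀ u = x₀' u)
    {φ : ℝ → ℝ → S → ℝ} (h : IsMFSolution G Runi Rpair x₀ φ) :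
    IsMFSolution G' Runi Rpair x₀' φ := by
  obtain ⟨h1, h2, h3, h4⟩ := h
  refine ⟨h1, h2, fun t ht => ?_, h4⟩
  filter_upwards [h3 t ht, hx, ae_restrict_mem measurableSet_Ioc] with u h5 h6 hu s
  rw [h5 s, h6]
  congr 1
  refine integral_congr_ae (Eventually.of_forall fun τ => ?_)
  simp only [drift_eq]
  refine Finset.sum_congr rfl fun s' _ => ?_
  congr 2
  refine setIntegral_congr_fun measurableSet_Ioc fun v hv => ?_
  simp only [hG u hu v hv]

end uniq

/-- Well-posedness of the graphon mean field equation: for every probability-vector valued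
initial condition there is a solution, unique up to `L₂`-null modifications. -/
theorem graphon_mfe_wellposed {S : Type*} [Fintype S] [Nonempty S] [DecidableEq S]
    (G : ℝ → ℝ → ℝ) (hGmeas : Measurable fun p : ℝ × ℝ => G p.1 p.2)
    (hG01 : ∀ u ∈ Ioc (0:ℝ) 1, ∀ v ∈ Ioc (0:ℝ) 1, G u v ∈ Icc (0:ℝ) 1)
    (C_R : ℝ) (hCR : 0 ≤ C_R)
    (runi : ℝ → S → S → ℝ) (rpair : ℝ → ℝ → S → S → S → ℝ)
    (hruniMeas : ∀ s s', Measurable fun u => runi u s s')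
    (hrpairMeas : ∀ s s' sl, Measurable fun p : ℝ × ℝ => rpair p.1 p.2 s s' sl)
    (hruni : ∀ u s s', runi u s s' ∈ Icc (0:ℝ) C_R)
    (hrpair : ∀ u v s s' sl, rpair u v s s' sl ∈ Icc (0:ℝ) C_R)
    (x₀ : ℝ → S → ℝ) (hx₀meas : ∀ s, Measurable fun u => x₀ u s)
    (hx₀prob : ∀ᵐ u ∂(volume.restrict (Ioc (0:ℝ) 1)),
      (∀ s, 0 ≤ x₀ u s) ∧ ∑ s, x₀ u s = 1) :
    ∃ φ : ℝ → ℝ → S → ℝ,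
      IsMFSolution G (RuniOf runi) (RpairOf rpair) x₀ φ ∧
      ∀ ψ : ℝ → ℝ → S → ℝ, IsMFSolution G (RuniOf runi) (RpairOf rpair) x₀ ψ →
        ∀ t, 0 ≤ t → l2norm (fun u s => φ t u s - ψ t u s) = 0 := by
  classical
  set G' : ℝ → ℝ → ℝ := fun u v =>
    if (u, v) ∈ Ioc (0:ℝ) 1 ×ˢ Ioc (0:ℝ) 1 then G u v else 0 with hG'
  have hGG : ∀ u ∈ Ioc (0:ℝ) 1, ∀ v ∈ Ioc (0:ℝ) 1, G u v = G' u v := fun u hu v hv => by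
    simp only [hG']
    rw [if_pos (mk_mem_prod hu hv)]
  have hGb : ∀ u v, G' u v ∈ Icc (0:ℝ) 1 := fun u v => by
    by_cases hm : (u, v) ∈ Ioc (0:ℝ) 1 ×ˢ Ioc (0:ℝ) 1
    · rw [← hGG u hm.1 v hm.2]
      exact hG01 u hm.1 v hm.2
    · simp only [hG', if_neg hm]
      simp
  set A : Set ℝ := {u | (∀ s, 0 ≤ x₀ u s) ∧ ∑ s, x₀ u s = 1} with hA
  have hAm : MeasurableSet A := by
    have e : A = (⋂ s, {u : ℝ | 0 ≤ x₀ u s}) ∩ {u : ℝ | ∑ s, x₀ u s = 1} := by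
      ext p; simp [hA]
    rw [e]
    refine MeasurableSet.inter ?_ ?_
    · exact MeasurableSet.iInter fun s => measurableSet_le measurable_const (hx₀meas s)
    · exact measurableSet_eq_fun (Finset.measurable_sum _ fun s _ => hx₀meas s) measurable_const
  set y₀ : ℝ → S → ℝ := fun u s =>
    if u ∈ A then x₀ u s else if s = Classical.arbitrary S then 1 else 0 with hy₀
  have hxy : ∀ᵐ u ∂(volume.restrict (Ioc (0:ℝ) 1)), x₀ u = y₀ u := by
    filter_upwards [hx₀prob] with u hu
    have hm : u ∈ A := hu
    funext s
    simp only [hy₀, if_pos hm]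
  have hy₀p : IsProbFam y₀ := by
    refine ⟨fun s => Measurable.ite hAm (hx₀meas s) measurable_const, fun u s => ?_, fun u => ?_⟩
    · by_cases hm : u ∈ A
      · simp only [hy₀, if_pos hm]; exact hm.1 s
      · simp only [hy₀, if_neg hm]; split_ifs <;> norm_num
    · by_cases hm : u ∈ A
      · simp only [hy₀, if_pos hm]; exact hm.2
      · simp [hy₀, if_neg hm]
  have hsum : ∀ (f : S → ℝ) (s : S), (∀ s, f s ∈ Icc (0:ℝ) C_R) →
      |-(∑ st ∈ Finset.univ.erase s, f st)| ≤ Fintype.card S * C_R + 1 := by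
    intro f s hf
    rw [abs_neg, abs_of_nonneg (Finset.sum_nonneg fun i _ => (hf i).1)]
    have h1 : ∑ st ∈ Finset.univ.erase s, f st ≤ ∑ st, f st :=
      Finset.sum_le_sum_of_subset_of_nonneg (Finset.erase_subset _ _) fun i _ _ => (hf i).1
    have h2 : ∑ st, f st ≤ Fintype.card S * C_R := by
      simpa using Finset.sum_le_sum fun i (_ : i ∈ (Finset.univ : Finset S)) => (hf i).2
    linarith
  have hone : ∀ a ∈ Icc (0:ℝ) C_R, |a| ≤ Fintype.card S * C_R + 1 := by
    intro a ha
    have hc : (1:ℝ) ≤ Fintype.card S := by exact_mod_cast Fintype.card_pos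
    rw [abs_of_nonneg ha.1]
    nlinarith [ha.2]
  have hcol : ∀ (f : S → S → ℝ) (s' : S),
      ∑ s, (if s' = s then -(∑ st ∈ Finset.univ.erase s, f s st) else f s' s) = 0 := by
    intro f s'
    rw [← Finset.add_sum_erase _ _ (Finset.mem_univ s'), if_pos rfl, neg_add_eq_zero]
    refine Finset.sum_congr rfl fun s hs => ?_
    rw [if_neg (Finset.ne_of_mem_erase hs).symm]
  have good : GoodCoef G' (RuniOf runi) (RpairOf rpair) (Fintype.card S * C_R + 1) := by
    refine ⟨Measurable.ite (measurableSet_Ioc.prod measurableSet_Ioc) hGmeas measurable_const,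
      fun u v => (hGb u v).1, fun u v => (hGb u v).2, fun s s' => ?_, fun s s' sl => ?_,
      fun u s s' => ?_, fun u v s s' sl => ?_, fun u s s' hs => ?_, fun u v s s' sl hs => ?_,
      fun u s' => ?_, fun u v s' sl => ?_, by positivity⟩
    · unfold RuniOf
      split_ifs
      · exact (Finset.measurable_sum _ fun st _ => hruniMeas s st).neg
      · exact hruniMeas s' s
    · unfold RpairOf
      split_ifs
      · exact (Finset.measurable_sum _ fun st _ => hrpairMeas s st sl).neg
      · exact hrpairMeas s' s sl
    · unfold RuniOf
      split_ifs
      · exact hsum (fun st => runi u s st) s fun st => hruni u s st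
      · exact hone _ (hruni u s' s)
    · unfold RpairOf
      split_ifs
      · exact hsum (fun st => rpair u v s st sl) s fun st => hrpair u v s st sl
      · exact hone _ (hrpair u v s' s sl)
    · rw [RuniOf, if_neg hs]; exact (hruni u s' s).1
    · rw [RpairOf, if_neg hs]; exact (hrpair u v s' s sl).1
    · exact hcol (fun s st => runi u s st) s'
    · exact hcol (fun s st => rpair u v s st sl) s'
  obtain ⟨φ, hφ, sφ⟩ := good.exists_sol hy₀p
  have hxy' : ∀ᵐ u ∂(volume.restrict (Ioc (0:ℝ) 1)), y₀ u = x₀ u := by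
    filter_upwards [hxy] with u hu using hu.symm
  refine ⟨φ, sφ.congr (fun u hu v hv => (hGG u hu v hv).symm) hxy', fun ψ hψ t ht => ?_⟩
  exact good.unique_sol hφ sφ (hψ.congr hGG hxy) t ht
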